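/- Assume Σ_{l=1}^L γ_l M_l < |N|. Every Nash equilibrium m of the nonatomic base station association game is Pareto efficient: there is no congestion profile m' such that for every class l and all base stations j, k with m_{lj} > 0 and m'_{lk} > 0 one has c_{lk}(m') ≤ c_{lj}(m), with strict inequality holding for some such triple (l, j, k). -/

import Mathlib

open scoped BigOperators ENNReal

/-- `m` is a congestion profile: nonnegative entries, class `l` has total mass `Ml l`. -/
def IsProfile {L N : Type*} [Fintype N] (Ml : L → ℝ) (m : L → N → ℝ) : Prop :=
  (∀ l j, 0 ≤ m l j) ∧ ∀ l, (∑ j, m l j) = Ml l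

/-- Congestion `m_j = ∑_l γ_l m_{lj}` at base station `j`. -/
noncomputable def cong {L N : Type*} [Fintype L] (γ : L → ℝ) (m : L → N → ℝ) (j : N) : ℝ :=
  ∑ l, γ l * m l j

/-- The constant `g_{lj} = γ_l σ² / h_{lj}`. -/
noncomputable def gq {L N : Type*} (σ2 : ℝ) (γ : L → ℝ) (h : L → N → ℝ) (l : L) (j : N) : ℝ :=
  γ l * σ2 / h l j

/-- Cost density of class `l` at base station `j`: `g_{lj}/(1 − m_j)` if `m_j < 1`,
and `+∞` otherwise. -/
noncomputable def cd {L N : Type*} [Fintype L] (σ2 : ℝ) (γ : L → ℝ) (h : L → N → ℝ)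
    (m : L → N → ℝ) (l : L) (j : N) : ℝ≥0∞ :=
  if cong γ m j < 1 then ENNReal.ofReal (gq σ2 γ h l j / (1 - cong γ m j)) else ⊤

/-- `m` is a Nash equilibrium of the nonatomic association game: whenever class `l` has
positive mass at base station `j`, `j` has minimal cost density for class `l`. -/
def IsNE {L N : Type*} [Fintype L] (σ2 : ℝ) (γ : L → ℝ) (h : L → N → ℝ)
    (m : L → N → ℝ) : Prop :=
  ∀ (l : L) (j k : N), 0 < m l j → cd σ2 γ h m l j ≤ cd σ2 γ h m l k

theorem sum_cong_eq {L N : Type*} [Fintype L] [Fintype N] (γ Ml : L → ℝ) (m : L → N → ℝ)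
    (hm : IsProfile Ml m) : ∑ j, cong γ m j = ∑ l, γ l * Ml l := by
  unfold cong
  rw [Finset.sum_comm]
  refine Finset.sum_congr rfl fun l _ => ?_
  rw [← Finset.mul_sum, hm.2 l]

theorem exists_used_of_cong_pos {L N : Type*} [Fintype L] (γ : L → ℝ) (hγ : ∀ l, 0 < γ l)
    (m : L → N → ℝ) (j : N) (hj : 0 < cong γ m j) : ∃ l, 0 < m l j := by
  by_contra! hc
  have : cong γ m j ≤ 0 :=
    Finset.sum_nonpos fun l _ => mul_nonpos_of_nonneg_of_nonpos (hγ l).le (hc l)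
  linarith

/-- Under feasibility `∑_l γ_l M_l < |N|`: every Nash equilibrium of the nonatomic
association game is Pareto efficient: no other congestion profile weakly decreases the
cost density of every class (comparing base stations carrying positive mass of that
class), strictly for some class. -/
theorem nonatomic_ne_pareto {L N : Type*} [Fintype L] [Fintype N]
    (σ2 : ℝ) (hσ : 0 < σ2) (γ Ml : L → ℝ) (hγ : ∀ l, 0 < γ l) (hMl : ∀ l, 0 < Ml l)
    (h : L → N → ℝ) (hh : ∀ l j, 0 < h l j)
    (hfeas : (∑ l, γ l * Ml l) < Fintype.card N)
    (m : L → N → ℝ) (hm : IsProfile Ml m) (hNE : IsNE σ2 γ h m) :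
    ¬ ∃ m' : L → N → ℝ, IsProfile Ml m' ∧
      (∀ (l : L) (j k : N), 0 < m l j → 0 < m' l k →
        cd σ2 γ h m' l k ≤ cd σ2 γ h m l j) ∧
      (∃ (l : L) (j k : N), 0 < m l j ∧ 0 < m' l k ∧
        cd σ2 γ h m' l k < cd σ2 γ h m l j) := by
  rintro ⟨m', hm', hle, l, j, k, hmj, hmk, hlt⟩
  have hfin : ∃ k, cong γ m k < 1 := by
    by_contra! hc
    have h1 : ∑ _j : N, (1 : ℝ) ≤ ∑ j, cong γ m j := Finset.sum_le_sum fun j _ => hc j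
    rw [sum_cong_eq γ Ml m hm] at h1
    simp at h1
    linarith
  obtain ⟨k0, hk0⟩ := hfin
  have hlt1 : ∀ j, cong γ m j < 1 := by
    intro j
    by_contra hc
    obtain ⟨l, hl⟩ := exists_used_of_cong_pos γ hγ m j (by linarith)
    have := hNE l j k0 hl
    simp [cd, hc, hk0] at this
  have hcong : ∀ j, cong γ m' j ≤ cong γ m j := by
    intro j
    by_contra! hc
    have h0 : 0 ≤ cong γ m j := Finset.sum_nonneg fun l _ => mul_nonneg (hγ l).le (hm.1 l j)
    obtain ⟨l, hl⟩ := exists_used_of_cong_pos γ hγ m' j (by linarith)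
    obtain ⟨j0, hj0⟩ : ∃ j0, 0 < m l j0 := by
      by_contra! hn
      have h1 : ∑ j, m l j ≤ 0 := Finset.sum_nonpos fun j _ => hn j
      have h2 := hMl l
      rw [hm.2 l] at h1
      linarith
    have h1 := (hle l j0 j hj0 hl).trans (hNE l j0 j hj0)
    refine absurd h1 (not_le.mpr ?_)
    have hg : 0 < gq σ2 γ h l j := div_pos (mul_pos (hγ l) hσ) (hh l j)
    have hj := hlt1 j
    by_cases h' : cong γ m' j < 1
    · simp only [cd, hj, h', if_true]
      have hp : 0 < 1 - cong γ m' j := by linarith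
      rw [ENNReal.ofReal_lt_ofReal_iff (div_pos hg hp)]
      exact div_lt_div_of_pos_left hg hp (by linarith)
    · simp [cd, hj, h']
  have heq : ∀ j, cong γ m' j = cong γ m j := by
    have hs : ∑ j, cong γ m' j = ∑ j, cong γ m j := by
      rw [sum_cong_eq γ Ml m hm, sum_cong_eq γ Ml m' hm']
    intro j
    exact (Finset.sum_eq_sum_iff_of_le fun j _ => hcong j).mp hs j (Finset.mem_univ j)
  have h2 := hNE l j k hmj
  have h3 : cd σ2 γ h m' l k = cd σ2 γ h m l k := by simp only [cd, heq]
  rw [h3] at hlt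
  exact absurd h2 (not_le.mpr hlt)
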